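/- Fix n ≥ 1 players, and for each player j ∈ {1, …, n} let Σ_j be a nonempty finite strategy set and Σ̂_j ⊆ Σ_j a nonempty restricted strategy set; write Σ = Π_j Σ_j and Σ̂ = Π_j Σ̂_j. Let U_j : Σ → ℝ be the true-game payoff functions and Û_j : Σ → ℝ the empirical-game payoff functions, and let ε ≥ 0, γ ≥ 0 and σ ∈ Σ̂. Suppose: (i) (uniform ε-approximation) |U_j(τ) − Û_j(τ)| ≤ ε for every player j and every profile τ ∈ Σ̂; (ii) (γ-Nash equilibrium of the empirical game) for every player j and every s ∈ Σ̂_j, Û_j(σ_{-j}, s) ≤ Û_j(σ) + γ, where (σ_{-j}, s) denotes the profile σ with player j's strategy replaced by s; (iii) (termination condition) for every player j, max_{s ∈ Σ_j} U_j(σ_{-j}, s) = max_{s ∈ Σ̂_j} U_j(σ_{-j}, s). Then for every player j, the true-game regret Reg_j(σ) := max_{s ∈ Σ_j} U_j(σ_{-j}, s) − U_j(σ) satisfies Reg_j(σ) ≤ 2ε + γ. -/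

import Mathlib

/-- Proposition 3: a uniform ε-approximation turns any γ-Nash equilibrium of the
empirical game into a (2ε + γ)-equilibrium of the true game, given that upon
termination each player's best response over its full strategy set is attained
within its restricted set. -/
theorem stmt_1 {n : ℕ} (hn : 1 ≤ n)
    (S : Fin n → Type*) [∀ j, Fintype (S j)] [∀ j, Nonempty (S j)]
    [∀ j, DecidableEq (S j)]
    (Shat : ∀ j, Finset (S j)) (hShat : ∀ j, (Shat j).Nonempty)
    (U Uhat : Fin n → (∀ k, S k) → ℝ)
    (ε γ : ℝ) (hε : 0 ≤ ε) (hγ : 0 ≤ γ)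
    (σ : ∀ k, S k) (hσ : ∀ j, σ j ∈ Shat j)
    (happrox : ∀ j, ∀ τ : ∀ k, S k, (∀ k, τ k ∈ Shat k) → |U j τ - Uhat j τ| ≤ ε)
    (hnash : ∀ j, ∀ s ∈ Shat j,
      Uhat j (Function.update σ j s) ≤ Uhat j σ + γ)
    (hterm : ∀ j,
      (Finset.univ : Finset (S j)).sup' Finset.univ_nonempty
          (fun s => U j (Function.update σ j s))
        = (Shat j).sup' (hShat j) (fun s => U j (Function.update σ j s))) :
    ∀ j, (Finset.univ : Finset (S j)).sup' Finset.univ_nonempty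
        (fun s => U j (Function.update σ j s)) - U j σ ≤ 2 * ε + γ := by
  intro j
  rw [hterm j, sub_le_iff_le_add]
  refine Finset.sup'_le _ _ fun s hs => ?_
  have hmem : ∀ k, Function.update σ j s k ∈ Shat k := by
    intro k
    by_cases hk : k = j
    · subst hk
      simpa using hs
    · simpa [Function.update_of_ne hk] using hσ k
  have h1 := abs_le.mp (happrox j _ hmem)
  have h2 := abs_le.mp (happrox j σ hσ)
  have h3 := hnash j s hs
  linarith [h1.2, h2.1]
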